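/- Let K ≥ 2, let α ∈ ℝ^K with α_k > 0 for all k, let μ, ν > 0, let i ≠ j be indices in {1,…,K}, and set η = μα_i / (μα_i + να_j). Then ∫_0^1 ∫_Δ (ρ² + (1−ρ)²) · L_{ij}(θ,ρ) · D_α(θ) · W_{μ,ν}(ρ) dθ dρ = { [η·(μ+1)(μ+2) + (1−η)·μ(μ+1) + η·ν(ν+1) + (1−η)·(ν+1)(ν+2)] / ((μ+ν+1)(μ+ν+2)) } · ∫_0^1 ∫_Δ L_{ij}(θ,ρ) · D_α(θ) · W_{μ,ν}(ρ) dθ dρ. -/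

import Mathlib

open MeasureTheory Finset

/-- The parametrizing domain `{y ∈ ℝ^{K-1} : y_k > 0, Σ y_k < 1}` of the open
probability simplex on `K` coordinates. -/
def simplexDomain (K : ℕ) : Set (Fin (K - 1) → ℝ) :=
  {y | (∀ k, 0 < y k) ∧ ∑ k, y k < 1}

/-- The point of the simplex with coordinates `θ_k = y_k` for `k < K-1` and
`θ_K = 1 - Σ y_k`. -/
noncomputable def coordsOf {K : ℕ} (y : Fin (K - 1) → ℝ) : Fin K → ℝ :=
  fun i => if h : (i : ℕ) < K - 1 then y ⟨(i : ℕ), h⟩ else 1 - ∑ k, y k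

/-- The unnormalized Dirichlet density `D_α(θ) = ∏ θ_k^(α_k - 1)`. -/
noncomputable def dirDensity {K : ℕ} (α : Fin K → ℝ) (θ : Fin K → ℝ) : ℝ :=
  ∏ k, θ k ^ (α k - 1)

/-- The unnormalized Beta density `W_{μ,ν}(ρ) = ρ^(μ-1) (1-ρ)^(ν-1)`. -/
noncomputable def betaDensity (μ ν ρ : ℝ) : ℝ :=
  ρ ^ (μ - 1) * (1 - ρ) ^ (ν - 1)

/-- `L_{ij}(θ,ρ) = ρ θ_i/(θ_i+θ_j) + (1-ρ) θ_j/(θ_i+θ_j)`, the probability that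
a worker of reliability `ρ` prefers item `i` to item `j`. -/
noncomputable def likeL {K : ℕ} (i j : Fin K) (θ : Fin K → ℝ) (ρ : ℝ) : ℝ :=
  ρ * (θ i / (θ i + θ j)) + (1 - ρ) * (θ j / (θ i + θ j))

/-- `∫_0^1 ∫_Δ f(θ,ρ) dθ dρ`, the double integral over the simplex (via the
standard parametrization) and the unit interval. -/
noncomputable def dblIntegral (K : ℕ) (f : (Fin K → ℝ) → ℝ → ℝ) : ℝ :=
  ∫ ρ in Set.Ioo (0:ℝ) 1, ∫ y in simplexDomain K, f (coordsOf y) ρ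

open scoped ENNReal

theorem lintegral_comp_smul_of_pos {n : ℕ} {f : (Fin n → ℝ) → ℝ≥0∞} (hf : Measurable f)
    {s : ℝ} (hs : 0 < s) :
    ∫⁻ y, f y = ENNReal.ofReal (s ^ n) * ∫⁻ z, f (s • z) := by
  have h := lintegral_map (μ := (volume : Measure (Fin n → ℝ))) hf (measurable_const_smul s)
  rw [Measure.map_addHaar_smul volume hs.ne', lintegral_smul_measure] at h
  rw [← h, smul_eq_mul, ← mul_assoc, ← ENNReal.ofReal_mul (by positivity)]
  have : s ^ n * |(s ^ Module.finrank ℝ (Fin n → ℝ))⁻¹| = 1 := by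
    rw [Module.finrank_fin_fun, abs_of_pos (by positivity)]
    exact mul_inv_cancel₀ (by positivity)
  rw [this, ENNReal.ofReal_one, one_mul]

theorem measurableSet_orthant (ι : Type*) [Countable ι] :
    MeasurableSet {x : ι → ℝ | ∀ k, 0 < x k} := by
  rw [Set.ofPred_forall]
  exact MeasurableSet.iInter fun k => measurableSet_lt measurable_const (measurable_pi_apply k)

theorem measurableSet_simplexDomain (K : ℕ) : MeasurableSet (simplexDomain K) :=
  (measurableSet_orthant _).inter
    (measurableSet_lt (Finset.measurable_fun_sum _ fun k _ => measurable_pi_apply k)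
      measurable_const)

theorem coordsOf_succ {n : ℕ} (y : Fin n → ℝ) :
    coordsOf (K := n + 1) y = Fin.snoc (α := fun _ => ℝ) y (1 - ∑ k, y k) := by
  funext i
  refine Fin.lastCases ?_ (fun k => ?_) i
  · simp [coordsOf]
  · simp [coordsOf]

theorem coordsOf_succ_pos_iff {n : ℕ} (y : Fin n → ℝ) :
    (∀ k, 0 < coordsOf (K := n + 1) y k) ↔ y ∈ simplexDomain (n + 1) := by
  rw [coordsOf_succ, Fin.forall_fin_succ']
  simp [simplexDomain]

theorem measurable_coordsOf (K : ℕ) : Measurable (coordsOf (K := K)) := by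
  refine measurable_pi_iff.2 fun i => ?_
  unfold coordsOf
  split_ifs
  · fun_prop
  · fun_prop

/-- Integration of a homogeneous function against `exp (-∑ x)` over the positive orthant factors
through the simplex. -/
theorem lintegral_orthant_of_homogeneous {n : ℕ} {F : (Fin (n + 1) → ℝ) → ℝ≥0∞}
    (hF : Measurable F) (d : ℝ)
    (hhom : ∀ s : ℝ, 0 < s → ∀ x, (∀ k, 0 < x k) → F (s • x) = ENNReal.ofReal (s ^ d) * F x) :
    ∫⁻ x in {x | ∀ k, 0 < x k}, F x * ENNReal.ofReal (Real.exp (-∑ k, x k))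
      = (∫⁻ s in Set.Ioi (0 : ℝ), ENNReal.ofReal (s ^ n * s ^ d * Real.exp (-s)))
        * ∫⁻ y in simplexDomain (n + 1), F (coordsOf y) := by
  set P : Set (Fin (n + 1) → ℝ) := {x | ∀ k, 0 < x k}
  have hPm : MeasurableSet P := measurableSet_orthant _
  set G : (Fin (n + 1) → ℝ) → ℝ≥0∞ :=
    fun x => P.indicator F x * ENNReal.ofReal (Real.exp (-∑ k, x k)) with hG
  have hGm : Measurable G := (hF.indicator hPm).mul (by fun_prop)
  have hsnoc : Measurable fun p : ℝ × (Fin n → ℝ) =>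
      (Fin.snoc (α := fun _ => ℝ) p.2 p.1 : Fin (n + 1) → ℝ) := by
    refine measurable_pi_iff.2 fun i => ?_
    refine Fin.lastCases ?_ (fun k => ?_) i
    · simpa using measurable_fst
    · simp only [Fin.snoc_castSucc]
      fun_prop
  have hsimplex : ∫⁻ y in simplexDomain (n + 1), F (coordsOf y)
      = ∫⁻ z : Fin n → ℝ, P.indicator F (Fin.snoc (α := fun _ => ℝ) z (1 - ∑ k, z k)) := by
    rw [← lintegral_indicator (measurableSet_simplexDomain _)]
    refine lintegral_congr fun z => ?_
    rw [← coordsOf_succ]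
    by_cases hz : z ∈ simplexDomain (n + 1)
    · rw [Set.indicator_of_mem hz, Set.indicator_of_mem]
      exact (coordsOf_succ_pos_iff z).2 hz
    · rw [Set.indicator_of_notMem hz, Set.indicator_of_notMem]
      exact fun h => hz ((coordsOf_succ_pos_iff z).1 h)
  have hslice : ∀ s : ℝ,
      ∫⁻ y : Fin n → ℝ, G (Fin.snoc (α := fun _ => ℝ) y (s - ∑ k, y k))
      = (Set.Ioi (0 : ℝ)).indicator
          (fun s => ENNReal.ofReal (s ^ n * s ^ d * Real.exp (-s))) s
        * ∫⁻ y in simplexDomain (n + 1), F (coordsOf y) := by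
    intro s
    have hsum : ∀ y : Fin n → ℝ,
        ∑ k, (Fin.snoc (α := fun _ => ℝ) y (s - ∑ k, y k) : Fin (n + 1) → ℝ) k = s := by
      intro y
      simp [Fin.sum_univ_castSucc]
    have hGs : Measurable fun y : Fin n → ℝ =>
        G (Fin.snoc (α := fun _ => ℝ) y (s - ∑ k, y k)) :=
      hGm.comp (hsnoc.comp (show Measurable fun y : Fin n → ℝ => (s - ∑ k, y k, y) by fun_prop))
    by_cases hs : 0 < s
    · rw [Set.indicator_of_mem (Set.mem_Ioi.2 hs),
        lintegral_comp_smul_of_pos hGs hs, hsimplex]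
      have hpt : ∀ z : Fin n → ℝ,
          G (Fin.snoc (α := fun _ => ℝ) (s • z) (s - ∑ k, (s • z) k))
          = ENNReal.ofReal (s ^ d * Real.exp (-s))
            * P.indicator F (Fin.snoc (α := fun _ => ℝ) z (1 - ∑ k, z k)) := by
        intro z
        simp only [hG]
        rw [hsum]
        have hsm : (Fin.snoc (α := fun _ => ℝ) (s • z) (s - ∑ k, (s • z) k) : Fin (n + 1) → ℝ)
            = s • (Fin.snoc (α := fun _ => ℝ) z (1 - ∑ k, z k) : Fin (n + 1) → ℝ) := by
          funext i
          refine Fin.lastCases ?_ (fun k => ?_) i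
          · simp [← Finset.mul_sum, mul_sub]
          · simp
        rw [hsm]
        generalize (Fin.snoc (α := fun _ => ℝ) z (1 - ∑ k, z k) : Fin (n + 1) → ℝ) = x
        by_cases hx : x ∈ P
        · have hsx : s • x ∈ P := fun k => mul_pos hs (hx k)
          rw [Set.indicator_of_mem hx, Set.indicator_of_mem hsx, hhom s hs x hx,
            ENNReal.ofReal_mul (by positivity)]
          ring
        · have hsx : s • x ∉ P := fun h => hx fun k => (mul_pos_iff_of_pos_left hs).1 (h k)
          rw [Set.indicator_of_notMem hx, Set.indicator_of_notMem hsx]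
          simp
      simp only [hpt]
      rw [lintegral_const_mul' _ _ ENNReal.ofReal_ne_top, ← mul_assoc,
        ← ENNReal.ofReal_mul (by positivity), mul_assoc (s ^ n)]
    · rw [Set.indicator_of_notMem (by simpa using hs), zero_mul]
      refine (lintegral_congr fun y => ?_).trans lintegral_zero
      simp only [hG]
      rw [Set.indicator_of_notMem, zero_mul]
      intro hy
      refine hs ?_
      rw [← hsum y]
      exact Finset.sum_pos (fun k _ => hy k) Finset.univ_nonempty
  calc ∫⁻ x in P, F x * ENNReal.ofReal (Real.exp (-∑ k, x k))
      = ∫⁻ x, G x := by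
        rw [← lintegral_indicator hPm]
        refine lintegral_congr fun x => ?_
        by_cases hx : x ∈ P <;> simp [hG, hx]
    _ = ∫⁻ p : ℝ × (Fin n → ℝ), G (Fin.snoc (α := fun _ => ℝ) p.2 p.1) := by
        have h := (volume_preserving_piFinSuccAbove (fun _ : Fin (n + 1) => ℝ)
          (Fin.last n)).symm.lintegral_comp hGm
        rw [← h]
        refine lintegral_congr fun p => ?_
        rw [MeasurableEquiv.piFinSuccAbove_symm_apply]
        exact congrArg G (Fin.insertNth_last' p.1 p.2)
    _ = ∫⁻ y : Fin n → ℝ, ∫⁻ t : ℝ, G (Fin.snoc (α := fun _ => ℝ) y t) :=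
        lintegral_prod_symm' _ (hGm.comp hsnoc)
    _ = ∫⁻ y : Fin n → ℝ, ∫⁻ s : ℝ, G (Fin.snoc (α := fun _ => ℝ) y (s - ∑ k, y k)) := by
        refine lintegral_congr fun y => ?_
        exact (lintegral_sub_right_eq_self
          (fun t => G (Fin.snoc (α := fun _ => ℝ) y t)) (∑ k, y k)).symm
    _ = ∫⁻ s : ℝ, ∫⁻ y : Fin n → ℝ, G (Fin.snoc (α := fun _ => ℝ) y (s - ∑ k, y k)) := by
        refine lintegral_lintegral_swap (Measurable.aemeasurable ?_)
        exact hGm.comp (hsnoc.comp (show Measurable fun q : (Fin n → ℝ) × ℝ =>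
          (q.2 - ∑ k, q.1 k, q.1) by fun_prop))
    _ = _ := by
        simp only [hslice]
        rw [lintegral_mul_const _ (Measurable.indicator (by fun_prop) measurableSet_Ioi),
          lintegral_indicator measurableSet_Ioi]

theorem lintegral_orthant_prod_rpow_mul_exp {ι : Type*} [Fintype ι] {β c : ι → ℝ}
    (hβ : ∀ k, 0 < β k) (hc : ∀ k, 0 < c k) :
    ∫⁻ x : ι → ℝ in {x | ∀ k, 0 < x k},
        ENNReal.ofReal ((∏ k, x k ^ (β k - 1)) * Real.exp (-∑ k, c k * x k))
      = ENNReal.ofReal (∏ k, (1 / c k) ^ β k * Real.Gamma (β k)) := by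
  set f : ι → ℝ → ℝ := fun k =>
    (Set.Ioi (0 : ℝ)).indicator fun t => t ^ (β k - 1) * Real.exp (-(c k * t)) with hf
  have hint : ∀ k, ∫ t, f k t = (1 / c k) ^ β k * Real.Gamma (β k) := fun k => by
    rw [hf, integral_indicator measurableSet_Ioi,
      Real.integral_rpow_mul_exp_neg_mul_Ioi (hβ k) (hc k)]
  have hfi : ∀ k, Integrable (f k) := fun k => by
    refine Integrable.of_integral_ne_zero ?_
    rw [hint]
    have := Real.Gamma_pos_of_pos (hβ k)
    have := hc k
    positivity
  have hnn : ∀ k t, 0 ≤ f k t := fun k t =>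
    Set.indicator_nonneg (fun t ht => mul_nonneg (Real.rpow_nonneg (le_of_lt ht) _)
      (Real.exp_pos _).le) t
  rw [← lintegral_indicator (measurableSet_orthant ι)]
  calc _ = ∫⁻ x : ι → ℝ, ENNReal.ofReal (∏ k, f k (x k)) := by
        refine lintegral_congr fun x => ?_
        by_cases hx : ∀ k, 0 < x k
        · rw [Set.indicator_of_mem (show x ∈ {x : ι → ℝ | ∀ k, 0 < x k} from hx)]
          congr 1
          rw [← Finset.sum_neg_distrib, Real.exp_sum, ← Finset.prod_mul_distrib]
          refine Finset.prod_congr rfl fun k _ => ?_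
          simp [hf, hx k]
        · rw [Set.indicator_of_notMem (show x ∉ {x : ι → ℝ | ∀ k, 0 < x k} from hx)]
          push Not at hx
          obtain ⟨k, hk⟩ := hx
          rw [Finset.prod_eq_zero (Finset.mem_univ k) (by simp [hf, hk]), ENNReal.ofReal_zero]
    _ = _ := by
        rw [volume_pi, ← ofReal_integral_eq_lintegral_ofReal (Integrable.fintype_prod hfi)
          (Filter.Eventually.of_forall fun x => Finset.prod_nonneg fun k _ => hnn k _)]
        simp only [integral_fintype_prod_eq_prod, hint]

theorem measurable_dirDensity {K : ℕ} (α : Fin K → ℝ) : Measurable (dirDensity α) := by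
  unfold dirDensity
  fun_prop

theorem dirDensity_add_single {K : ℕ} (α : Fin K → ℝ) (m : Fin K) {x : Fin K → ℝ}
    (hx : ∀ k, 0 < x k) :
    ∏ k, x k ^ (α k + (if k = m then 1 else 0) - 1) = dirDensity α x * x m := by
  rw [dirDensity, ← Finset.prod_ite_eq' Finset.univ m (fun k => x k) |>.trans (if_pos (mem_univ m)),
    ← Finset.prod_mul_distrib]
  refine Finset.prod_congr rfl fun k _ => ?_
  split_ifs
  · rw [← Real.rpow_add_one (hx k).ne']
    congr 1
    ring
  · simp

theorem lintegral_exp_neg_mul_Ioi {a : ℝ} (ha : 0 < a) :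
    ∫⁻ t in Set.Ioi (0 : ℝ), ENNReal.ofReal (Real.exp (-(a * t))) = ENNReal.ofReal (1 / a) := by
  have hint : ∫ t in Set.Ioi (0 : ℝ), Real.exp (-(a * t)) = 1 / a := by
    simpa using Real.integral_rpow_mul_exp_neg_mul_Ioi one_pos ha
  rw [← hint, ofReal_integral_eq_lintegral_ofReal]
  · refine Integrable.of_integral_ne_zero ?_
    rw [hint]
    positivity
  · exact Filter.Eventually.of_forall fun t => (Real.exp_pos _).le

/-- The dependence of the orthant integral of `x_m / (x_i + x_j)` on `m ∈ {i, j}` is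
proportional to `α_m`. -/
theorem lintegral_orthant_ratio {K : ℕ} {α : Fin K → ℝ} (hα : ∀ k, 0 < α k) {i j : Fin K}
    (hij : i ≠ j) {m : Fin K} (hm : m = i ∨ m = j) :
    ∫⁻ x : Fin K → ℝ in {x | ∀ k, 0 < x k},
        ENNReal.ofReal (x m / (x i + x j) * dirDensity α x) * ENNReal.ofReal (Real.exp (-∑ k, x k))
      = ENNReal.ofReal (α m) * ∫⁻ t in Set.Ioi (0 : ℝ), ENNReal.ofReal
          (1 / (1 + t) * ∏ k, (1 / (1 + if k = i ∨ k = j then t else 0)) ^ α k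
            * Real.Gamma (α k)) := by
  set c : ℝ → Fin K → ℝ := fun t k => 1 + if k = i ∨ k = j then t else 0 with hc
  have hcpos : ∀ t : ℝ, 0 < t → ∀ k, 0 < c t k := fun t ht k => by
    simp only [hc]
    split_ifs <;> positivity
  set β : Fin K → ℝ := fun k => α k + if k = m then 1 else 0 with hβ
  have hβpos : ∀ k, 0 < β k := fun k => by
    have := hα k
    simp only [hβ]
    split_ifs <;> positivity
  have hsum : ∀ t (x : Fin K → ℝ), ∑ k, c t k * x k = (∑ k, x k) + (x i + x j) * t := by
    intro t x
    have h : ∑ k, (if k = i ∨ k = j then t else 0) * x k = (x i + x j) * t := by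
      rw [Finset.sum_eq_add_of_mem i j (mem_univ _) (mem_univ _) hij]
      · simp [mul_comm, mul_add]
      · rintro k - ⟨hki, hkj⟩
        simp [hki, hkj]
    simp only [hc, add_mul, one_mul, Finset.sum_add_distrib] at h ⊢
    rw [h]
  have hmeas : Measurable fun p : (Fin K → ℝ) × ℝ => ENNReal.ofReal
      ((∏ k, p.1 k ^ (β k - 1)) * Real.exp (-∑ k, c p.2 k * p.1 k)) := by
    simp only [hsum]
    fun_prop
  calc _ = ∫⁻ x : Fin K → ℝ in {x | ∀ k, 0 < x k}, ∫⁻ t in Set.Ioi (0 : ℝ), ENNReal.ofReal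
          ((∏ k, x k ^ (β k - 1)) * Real.exp (-∑ k, c t k * x k)) := by
        refine setLIntegral_congr_fun (measurableSet_orthant _) fun x hx => ?_
        have hD : 0 < dirDensity α x := Finset.prod_pos fun k _ => Real.rpow_pos_of_pos (hx k) _
        have hxm := hx m
        have hxs : 0 < x i + x j := add_pos (hx i) (hx j)
        simp only [hsum, hβ, dirDensity_add_single α m hx, neg_add, Real.exp_add, ← mul_assoc]
        have hsplit : ∀ t : ℝ, ENNReal.ofReal (dirDensity α x * x m * Real.exp (-∑ k, x k)
              * Real.exp (-((x i + x j) * t)))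
            = ENNReal.ofReal (dirDensity α x * x m * Real.exp (-∑ k, x k))
              * ENNReal.ofReal (Real.exp (-((x i + x j) * t))) := fun t =>
          ENNReal.ofReal_mul (by positivity)
        simp only [hsplit]
        rw [lintegral_const_mul' _ _ ENNReal.ofReal_ne_top, lintegral_exp_neg_mul_Ioi hxs,
          ← ENNReal.ofReal_mul (by positivity), ← ENNReal.ofReal_mul (by positivity)]
        congr 1
        field_simp
    _ = ∫⁻ t in Set.Ioi (0 : ℝ), ∫⁻ x : Fin K → ℝ in {x | ∀ k, 0 < x k}, ENNReal.ofReal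
          ((∏ k, x k ^ (β k - 1)) * Real.exp (-∑ k, c t k * x k)) :=
        lintegral_lintegral_swap hmeas.aemeasurable
    _ = ∫⁻ t in Set.Ioi (0 : ℝ), ENNReal.ofReal (α m) * ENNReal.ofReal
          (1 / (1 + t) * ∏ k, (1 / c t k) ^ α k * Real.Gamma (α k)) := by
        refine setLIntegral_congr_fun measurableSet_Ioi fun t ht => ?_
        have ht : 0 < t := ht
        rw [lintegral_orthant_prod_rpow_mul_exp hβpos (hcpos t ht),
          ← ENNReal.ofReal_mul (hα m).le]
        congr 1
        have hfac : ∀ k, (1 / c t k) ^ β k * Real.Gamma (β k)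
            = (if k = m then α m * (1 / (1 + t)) else 1)
              * ((1 / c t k) ^ α k * Real.Gamma (α k)) := by
          intro k
          by_cases hk : k = m
          · subst hk
            have hck : c t k = 1 + t := by simp [hc, hm]
            have h1 : (1 / (1 + t) : ℝ) ≠ 0 := by positivity
            simp only [hβ, if_true, hck]
            rw [Real.rpow_add_one h1, Real.Gamma_add_one (hα k).ne']
            ring
          · simp [hβ, hk]
        simp only [hfac]
        rw [Finset.prod_mul_distrib, Finset.prod_ite_eq' Finset.univ m, if_pos (mem_univ m)]
        ring
    _ = _ := lintegral_const_mul' _ _ ENNReal.ofReal_ne_top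

theorem lintegral_orthant_ratio_ne_top {K : ℕ} {α : Fin K → ℝ} (hα : ∀ k, 0 < α k) {i j : Fin K}
    {m : Fin K} (hm : m = i ∨ m = j) :
    ∫⁻ x : Fin K → ℝ in {x | ∀ k, 0 < x k},
        ENNReal.ofReal (x m / (x i + x j) * dirDensity α x)
          * ENNReal.ofReal (Real.exp (-∑ k, x k)) ≠ ∞ := by
  have h := lintegral_orthant_prod_rpow_mul_exp hα (c := fun _ => 1) (fun _ => one_pos)
  refine ne_top_of_le_ne_top (h ▸ ENNReal.ofReal_ne_top) ?_
  refine setLIntegral_mono' (measurableSet_orthant _) fun x hx => ?_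
  have hD : 0 < dirDensity α x := Finset.prod_pos fun k _ => Real.rpow_pos_of_pos (hx k) _
  have hi := hx i
  have hj := hx j
  have hxm := hx m
  rw [← ENNReal.ofReal_mul (by positivity)]
  simp only [one_mul]
  refine ENNReal.ofReal_le_ofReal (mul_le_mul_of_nonneg_right ?_ (Real.exp_pos _).le)
  refine mul_le_of_le_one_left hD.le ((div_le_one (by positivity)).2 ?_)
  rcases hm with rfl | rfl <;> linarith

/-- Dirichlet expectations of `θ_i / (θ_i + θ_j)` and `θ_j / (θ_i + θ_j)` are finite and in ratio
`α_i : α_j`. -/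
theorem lintegral_simplex_ratio {K : ℕ} (hK : 2 ≤ K) {α : Fin K → ℝ} (hα : ∀ k, 0 < α k)
    {i j : Fin K} (hij : i ≠ j) :
    ∃ c : ℝ≥0∞, ∀ m, m = i ∨ m = j →
      ∫⁻ y in simplexDomain K, ENNReal.ofReal
        (coordsOf y m / (coordsOf y i + coordsOf y j) * dirDensity α (coordsOf y))
        = ENNReal.ofReal (α m) * c ∧ ENNReal.ofReal (α m) * c ≠ ∞ := by
  obtain ⟨n, rfl⟩ : ∃ n, K = n + 1 := ⟨K - 1, by omega⟩
  set d : ℝ := ∑ k, (α k - 1) with hd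
  set Γ : ℝ≥0∞ := ∫⁻ s in Set.Ioi (0 : ℝ), ENNReal.ofReal (s ^ n * s ^ d * Real.exp (-s))
  have hα0 : 0 < ∑ k, α k := Finset.sum_pos (fun k _ => hα k) Finset.univ_nonempty
  have hΓval : Γ = ENNReal.ofReal (Real.Gamma (∑ k, α k)) := by
    rw [Real.Gamma_eq_integral hα0, ofReal_integral_eq_lintegral_ofReal
      (Real.GammaIntegral_convergent hα0) (ae_restrict_of_forall_mem measurableSet_Ioi
        fun s hs => mul_nonneg (Real.exp_pos _).le (Real.rpow_nonneg (le_of_lt hs) _))]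
    refine setLIntegral_congr_fun measurableSet_Ioi fun s hs => ?_
    have hs : 0 < s := hs
    rw [mul_comm, ← Real.rpow_natCast, ← Real.rpow_add hs]
    congr 3
    rw [hd, Finset.sum_sub_distrib]
    simp
    ring
  have hΓ0 : Γ ≠ 0 := by
    rw [hΓval]
    exact (ENNReal.ofReal_pos.2 (Real.Gamma_pos_of_pos hα0)).ne'
  have hΓt : Γ ≠ ∞ := hΓval ▸ ENNReal.ofReal_ne_top
  have hpolar : ∀ m, m = i ∨ m = j → _ := fun m hm =>
    lintegral_orthant_of_homogeneous (n := n)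
      (F := fun x => ENNReal.ofReal (x m / (x i + x j) * dirDensity α x))
      (by have := measurable_dirDensity α; fun_prop) d (by
        intro s hs x hx
        rw [← ENNReal.ofReal_mul (Real.rpow_nonneg hs.le _)]
        congr 1
        have hD : dirDensity α (s • x) = s ^ d * dirDensity α x := by
          simp only [dirDensity, Pi.smul_apply, smul_eq_mul, hd]
          rw [Real.rpow_sum_of_pos hs, ← Finset.prod_mul_distrib]
          exact Finset.prod_congr rfl fun k _ => Real.mul_rpow hs.le (hx k).le
        rw [hD]
        simp only [Pi.smul_apply, smul_eq_mul]
        rw [← mul_add, mul_div_mul_left _ _ hs.ne']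
        ring)
  refine ⟨Γ⁻¹ * ∫⁻ t in Set.Ioi (0 : ℝ), ENNReal.ofReal
    (1 / (1 + t) * ∏ k, (1 / (1 + if k = i ∨ k = j then t else 0)) ^ α k
      * Real.Gamma (α k)), fun m hm => ?_⟩
  have h := hpolar m hm
  have hfin := lintegral_orthant_ratio_ne_top hα hm
  rw [lintegral_orthant_ratio hα hij hm] at h hfin
  rw [mul_left_comm]
  refine ⟨?_, ENNReal.mul_ne_top (ENNReal.inv_ne_top.2 hΓ0) hfin⟩
  rw [h, ← mul_assoc, ENNReal.inv_mul_cancel hΓ0 hΓt, one_mul]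

theorem integral_simplex_ratio {K : ℕ} (hK : 2 ≤ K) {α : Fin K → ℝ} (hα : ∀ k, 0 < α k)
    {i j : Fin K} (hij : i ≠ j) :
    ∃ c : ℝ, ∀ m, m = i ∨ m = j →
      IntegrableOn (fun y => coordsOf y m / (coordsOf y i + coordsOf y j)
        * dirDensity α (coordsOf y)) (simplexDomain K) ∧
      ∫ y in simplexDomain K, coordsOf y m / (coordsOf y i + coordsOf y j)
        * dirDensity α (coordsOf y) = α m * c := by
  obtain ⟨c, hc⟩ := lintegral_simplex_ratio hK hα hij
  obtain ⟨n, rfl⟩ : ∃ n, K = n + 1 := ⟨K - 1, by omega⟩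
  refine ⟨c.toReal, fun m hm => ?_⟩
  obtain ⟨heq, hfin⟩ := hc m hm
  have hmeas : Measurable fun y => coordsOf y m / (coordsOf y i + coordsOf y j)
      * dirDensity α (coordsOf y) := by
    have := measurable_dirDensity α
    have := measurable_coordsOf (n + 1)
    fun_prop
  have hnn : 0 ≤ᵐ[volume.restrict (simplexDomain (n + 1))] fun y =>
      coordsOf y m / (coordsOf y i + coordsOf y j) * dirDensity α (coordsOf y) := by
    refine ae_restrict_of_forall_mem (measurableSet_simplexDomain _) fun y hy => ?_
    have hpos := (coordsOf_succ_pos_iff y).2 hy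
    have hm := hpos m
    have hi := hpos i
    have hj := hpos j
    have hD : 0 < dirDensity α (coordsOf y) :=
      Finset.prod_pos fun k _ => Real.rpow_pos_of_pos (hpos k) _
    positivity
  refine ⟨(lintegral_ofReal_ne_top_iff_integrable hmeas.aestronglyMeasurable hnn).1
    (heq ▸ hfin), ?_⟩
  rw [integral_eq_lintegral_of_nonneg_ae hnn hmeas.aestronglyMeasurable, heq, ENNReal.toReal_mul,
    ENNReal.toReal_ofReal (hα m).le]

theorem integral_betaDensity {a b : ℝ} (ha : 0 < a) (hb : 0 < b) :
    ∫ ρ in Set.Ioo (0 : ℝ) 1, betaDensity a b ρ = ProbabilityTheory.beta a b := by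
  have hβ := ProbabilityTheory.beta_pos ha hb
  have h := ProbabilityTheory.lintegral_betaPDF_eq_one ha hb
  rw [ProbabilityTheory.lintegral_betaPDF, ← ENNReal.toReal_eq_one_iff,
    ← integral_eq_lintegral_of_nonneg_ae] at h
  · simp_rw [mul_assoc, integral_const_mul] at h
    field_simp at h
    exact h
  · refine ae_restrict_of_forall_mem measurableSet_Ioo fun x hx => ?_
    have := hx.1
    have : 0 < 1 - x := sub_pos.2 hx.2
    positivity
  · exact Measurable.aestronglyMeasurable (by fun_prop)

theorem integrableOn_betaDensity {a b : ℝ} (ha : 0 < a) (hb : 0 < b) :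
    IntegrableOn (betaDensity a b) (Set.Ioo (0 : ℝ) 1) := by
  refine Integrable.of_integral_ne_zero ?_
  rw [integral_betaDensity ha hb]
  exact (ProbabilityTheory.beta_pos ha hb).ne'

theorem beta_add_one_left {a b : ℝ} (ha : 0 < a) (hb : 0 < b) :
    ProbabilityTheory.beta (a + 1) b = a / (a + b) * ProbabilityTheory.beta a b := by
  have h := (Real.Gamma_pos_of_pos (add_pos ha hb)).ne'
  have hab := (add_pos ha hb).ne'
  rw [ProbabilityTheory.beta, ProbabilityTheory.beta, add_right_comm, Real.Gamma_add_one ha.ne',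
    Real.Gamma_add_one hab]
  field_simp

theorem beta_add_one_right {a b : ℝ} (ha : 0 < a) (hb : 0 < b) :
    ProbabilityTheory.beta a (b + 1) = b / (a + b) * ProbabilityTheory.beta a b := by
  have h := (Real.Gamma_pos_of_pos (add_pos ha hb)).ne'
  have hab := (add_pos ha hb).ne'
  rw [ProbabilityTheory.beta, ProbabilityTheory.beta, ← add_assoc, Real.Gamma_add_one hb.ne',
    Real.Gamma_add_one hab]
  field_simp

theorem betaDensity_add_one_left {a b ρ : ℝ} (hρ : 0 < ρ) :
    betaDensity (a + 1) b ρ = ρ * betaDensity a b ρ := by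
  rw [betaDensity, betaDensity, add_sub_right_comm, Real.rpow_add_one hρ.ne']
  ring

theorem betaDensity_add_one_right {a b ρ : ℝ} (hρ : ρ < 1) :
    betaDensity a (b + 1) ρ = (1 - ρ) * betaDensity a b ρ := by
  rw [betaDensity, betaDensity, add_sub_right_comm, Real.rpow_add_one (sub_pos.2 hρ).ne']
  ring

theorem dblIntegral_mul_likeL {K : ℕ} {α : Fin K → ℝ} {i j : Fin K} {A B : ℝ}
    (hAi : IntegrableOn (fun y => coordsOf y i / (coordsOf y i + coordsOf y j)
      * dirDensity α (coordsOf y)) (simplexDomain K))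
    (hBi : IntegrableOn (fun y => coordsOf y j / (coordsOf y i + coordsOf y j)
      * dirDensity α (coordsOf y)) (simplexDomain K))
    (hA : ∫ y in simplexDomain K, coordsOf y i / (coordsOf y i + coordsOf y j)
      * dirDensity α (coordsOf y) = A)
    (hB : ∫ y in simplexDomain K, coordsOf y j / (coordsOf y i + coordsOf y j)
      * dirDensity α (coordsOf y) = B) (μ ν : ℝ) (g : ℝ → ℝ) :
    dblIntegral K (fun θ ρ => g ρ * (likeL i j θ ρ * dirDensity α θ * betaDensity μ ν ρ))
      = ∫ ρ in Set.Ioo (0 : ℝ) 1, g ρ * ((ρ * A + (1 - ρ) * B) * betaDensity μ ν ρ) := by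
  unfold dblIntegral
  congr 1
  funext ρ
  rw [integral_const_mul, integral_mul_const, ← hA, ← hB, ← integral_const_mul,
    ← integral_const_mul, ← integral_add (hAi.const_mul ρ) (hBi.const_mul (1 - ρ))]
  congr 2
  refine integral_congr_ae (Filter.Eventually.of_forall fun y => ?_)
  simp only [likeL]
  ring

/-- Posterior value of `ρ² + (1-ρ)²` for the worker's reliability after one
comparison in which the worker prefers item `i` to item `j`. -/
theorem heterogeneous_posterior_reliability_second (K : ℕ) (hK : 2 ≤ K)
    (α : Fin K → ℝ) (hα : ∀ k, 0 < α k) (μ ν : ℝ) (hμ : 0 < μ) (hν : 0 < ν)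
    (i j : Fin K) (hij : i ≠ j) (η : ℝ) (hη : η = μ * α i / (μ * α i + ν * α j)) :
    dblIntegral K (fun θ ρ =>
        (ρ ^ 2 + (1 - ρ) ^ 2) * (likeL i j θ ρ * dirDensity α θ * betaDensity μ ν ρ))
      = ((η * ((μ + 1) * (μ + 2)) + (1 - η) * (μ * (μ + 1))
            + η * (ν * (ν + 1)) + (1 - η) * ((ν + 1) * (ν + 2)))
          / ((μ + ν + 1) * (μ + ν + 2)))
        * dblIntegral K (fun θ ρ => likeL i j θ ρ * dirDensity α θ * betaDensity μ ν ρ) := by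
  obtain ⟨c, hc⟩ := integral_simplex_ratio hK hα hij
  obtain ⟨hAi, hA⟩ := hc i (Or.inl rfl)
  obtain ⟨hBi, hB⟩ := hc j (Or.inr rfl)
  have hone := dblIntegral_mul_likeL hAi hBi hA hB μ ν fun _ => 1
  simp only [one_mul] at hone
  rw [dblIntegral_mul_likeL hAi hBi hA hB μ ν fun ρ => ρ ^ 2 + (1 - ρ) ^ 2, hone]
  have hμ1 : 0 < μ + 1 := by positivity
  have hμ2 : 0 < μ + 1 + 1 := by positivity
  have hν1 : 0 < ν + 1 := by positivity
  have hν2 : 0 < ν + 1 + 1 := by positivity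
  have hden : ∫ ρ in Set.Ioo (0 : ℝ) 1, (ρ * (α i * c) + (1 - ρ) * (α j * c)) * betaDensity μ ν ρ
      = α i * c * ProbabilityTheory.beta (μ + 1) ν
        + α j * c * ProbabilityTheory.beta μ (ν + 1) := by
    rw [← integral_betaDensity hμ1 hν, ← integral_betaDensity hμ hν1, ← integral_const_mul,
      ← integral_const_mul, ← integral_add ((integrableOn_betaDensity hμ1 hν).const_mul _)
        ((integrableOn_betaDensity hμ hν1).const_mul _)]
    refine setIntegral_congr_fun measurableSet_Ioo fun ρ hρ => ?_
    simp only [betaDensity_add_one_left hρ.1, betaDensity_add_one_right hρ.2]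
    ring
  have hnum : ∫ ρ in Set.Ioo (0 : ℝ) 1, (ρ ^ 2 + (1 - ρ) ^ 2)
        * ((ρ * (α i * c) + (1 - ρ) * (α j * c)) * betaDensity μ ν ρ)
      = α i * c * ProbabilityTheory.beta (μ + 1 + 1 + 1) ν
        + α i * c * ProbabilityTheory.beta (μ + 1) (ν + 1 + 1)
        + α j * c * ProbabilityTheory.beta (μ + 1 + 1) (ν + 1)
        + α j * c * ProbabilityTheory.beta μ (ν + 1 + 1 + 1) := by
    have hμ3 : 0 < μ + 1 + 1 + 1 := by positivity
    have hν3 : 0 < ν + 1 + 1 + 1 := by positivity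
    have h1 := (integrableOn_betaDensity hμ3 hν).const_mul (α i * c)
    have h2 := (integrableOn_betaDensity hμ1 hν2).const_mul (α i * c)
    have h3 := (integrableOn_betaDensity hμ2 hν1).const_mul (α j * c)
    have h4 := (integrableOn_betaDensity hμ hν3).const_mul (α j * c)
    rw [← integral_betaDensity hμ3 hν, ← integral_betaDensity hμ1 hν2,
      ← integral_betaDensity hμ2 hν1, ← integral_betaDensity hμ hν3, ← integral_const_mul,
      ← integral_const_mul, ← integral_const_mul, ← integral_const_mul, ← integral_add h1 h2,
      ← integral_add (h1.fun_add h2) h3,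
      ← integral_add ((h1.fun_add h2).fun_add h3) h4]
    refine setIntegral_congr_fun measurableSet_Ioo fun ρ hρ => ?_
    simp only [betaDensity_add_one_left hρ.1, betaDensity_add_one_right hρ.2]
    ring
  rw [hden, hnum, beta_add_one_left hμ2 hν, beta_add_one_left hμ1 hν,
    beta_add_one_right hμ1 hν1, beta_add_one_right hμ1 hν, beta_add_one_left hμ1 hν1,
    beta_add_one_right hμ1 hν, beta_add_one_left hμ hν, beta_add_one_right hμ hν2,
    beta_add_one_right hμ hν1, beta_add_one_right hμ hν, hη]
  have hi := hα i
  have hj := hα j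
  field_simp
  ring
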